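/- Let H be a cograph on vertex set S and A, B ⊆ S. Writing Γ_{A∪B}(X) for the set of vertices of (A∪B) \ X adjacent to X, and c_H(X) for the number of components of H[X], we have: |Γ_{A∪B}(A∪B)| − c_H(A∪B) + |Γ_{A∪B}(A∩B)| − c_H(A∩B) ≤ |Γ_{A∪B}(A)| − c_H(A) + |Γ_{A∪B}(B)| − c_H(B). -/

import Mathlib

/-- A cograph: a graph with no induced path on four vertices. -/
def IsCograph {V : Type*} (G : SimpleGraph V) : Prop :=
  ∀ a b c d : V, a ≠ b → a ≠ c → a ≠ d → b ≠ c → b ≠ d → c ≠ d →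
    ¬ (G.Adj a b ∧ G.Adj b c ∧ G.Adj c d ∧ ¬G.Adj a c ∧ ¬G.Adj a d ∧ ¬G.Adj b d)

/-- The neighborhood of `X` restricted to `Z`: vertices of `Z \ X` adjacent to `X`. -/
def nbhdIn {S : Type*} (H : SimpleGraph S) (Z X : Finset S) : Set S :=
  {v : S | v ∈ Z ∧ v ∉ X ∧ ∃ x ∈ X, H.Adj x v}

/-- Number of connected components of the subgraph induced by `X`. -/
noncomputable def numComponents {S : Type*} (H : SimpleGraph S) (X : Finset S) : ℕ :=
  Nat.card (H.induce (X : Set S)).ConnectedComponent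

open SimpleGraph

/-- `X` splits into two nonempty parts with no edge of `G` between them. -/
def HasSplit {S : Type*} (G : SimpleGraph S) (X : Finset S) : Prop :=
  ∃ Y ⊆ X, Y.Nonempty ∧ (∃ z ∈ X, z ∉ Y) ∧ ∀ y ∈ Y, ∀ z ∈ X, z ∉ Y → ¬G.Adj y z

theorem IsCograph.compl {V : Type*} {G : SimpleGraph V} (h : IsCograph G) : IsCograph Gᶜ := by
  intro a b c d hab hac had hbc hbd hcd
  have := h b d a c
  simp only [compl_adj]
  grind [SimpleGraph.adj_comm]

theorem IsCograph.hasSplit_insert {S : Type*} [DecidableEq S] {G : SimpleGraph S}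
    (h : IsCograph G) {X : Finset S} {v : S} (hv : v ∉ X) (hX : HasSplit G X) :
    HasSplit G (insert v X) ∨ HasSplit Gᶜ (insert v X) := by
  classical
  obtain ⟨Y, hYX, hY, hZ, hYZ⟩ := hX
  by_contra! hcon
  obtain ⟨hG, hGc⟩ := hcon
  -- every nonempty union of components of `X` contains a neighbor of `v`
  have meets : ∀ W ⊆ X, W.Nonempty → (∀ y ∈ W, ∀ z ∈ X, z ∉ W → ¬G.Adj y z) →
      ∃ w ∈ W, G.Adj v w := by
    intro W hWX hW hWc
    by_contra! hno
    refine hG ⟨W, hWX.trans (Finset.subset_insert _ _), hW, ⟨v, by simp, fun hvW => hv (hWX hvW)⟩,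
      fun y hy z hz hzW => ?_⟩
    rcases Finset.mem_insert.1 hz with rfl | hz
    · exact fun hadj => hno y hy hadj.symm
    · exact hWc y hy z hz hzW
  have full : ∀ W ⊆ X, (∃ z ∈ X, z ∉ W) → (∀ y ∈ W, ∀ z ∈ X, z ∉ W → ¬G.Adj y z) →
      ∀ m ∈ W, G.Adj v m := by
    intro W hWX ⟨z₀, hz₀, hz₀W⟩ hWc m hm
    by_contra hvm
    obtain ⟨z, hz, hvz⟩ := meets (X \ W) Finset.sdiff_subset ⟨z₀, by simp [hz₀, hz₀W]⟩ (by
      intro y hy z hz hzW hadj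
      simp only [Finset.mem_sdiff, not_and, not_not] at hy hzW
      exact hWc z (hzW hz) y hy.1 hy.2 hadj.symm)
    rw [Finset.mem_sdiff] at hz
    obtain ⟨w, hw, hvw⟩ := meets (W.filter fun x => ¬G.Adj v x)
      ((Finset.filter_subset _ _).trans hWX) ⟨m, by simp [hm, hvm]⟩ (by
        intro x hx y hy hyW hxy
        simp only [Finset.mem_filter, not_and, not_not] at hx hyW
        by_cases hyW' : y ∈ W
        · have hvy := hyW hyW'
          have h1 := hWc x hx.1 z hz.1 hz.2
          have h2 := hWc y hyW' z hz.1 hz.2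
          refine h z v y x ?_ ?_ ?_ ?_ ?_ ?_ ⟨hvz.symm, hvy, hxy.symm, fun e => h2 e.symm,
            fun e => h1 e.symm, hx.2⟩
          · exact hvz.ne'
          · rintro rfl; exact hz.2 hyW'
          · rintro rfl; exact hz.2 hx.1
          · exact hvy.ne
          · rintro rfl; exact hv (hWX hx.1)
          · exact hxy.ne'
        · exact hWc x hx.1 y hy hyW' hxy)
    exact (Finset.mem_filter.1 hw).2 hvw
  refine hGc ⟨{v}, by simp, by simp, ?_, ?_⟩
  · obtain ⟨y, hy⟩ := hY
    exact ⟨y, by simp [hYX hy], fun e => hv (Finset.mem_singleton.1 e ▸ hYX hy)⟩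
  · intro y hy z hz hzv
    obtain rfl := Finset.mem_singleton.1 hy
    have hzX : z ∈ X := by simpa [Finset.mem_singleton.not.1 hzv] using hz
    suffices G.Adj y z by simp [this]
    by_cases hzY : z ∈ Y
    · exact full Y hYX hZ hYZ z hzY
    · refine full (X \ Y) Finset.sdiff_subset ?_ ?_ z (by simp [hzX, hzY])
      · obtain ⟨a, ha⟩ := hY
        exact ⟨a, hYX ha, by simp [ha]⟩
      · intro a ha b hb hbY hadj
        simp only [Finset.mem_sdiff, not_and, not_not] at ha hbY
        exact hYZ b (hbY hb) a ha.1 ha.2 hadj.symm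

theorem IsCograph.hasSplit_or_compl {S : Type*} [DecidableEq S] {G : SimpleGraph S}
    (h : IsCograph G) (X : Finset S) (hX : 1 < X.card) : HasSplit G X ∨ HasSplit Gᶜ X := by
  induction X using Finset.induction_on with
  | empty => simp at hX
  | insert v X hv ih =>
    by_cases hX1 : 1 < X.card
    · rcases ih hX1 with h' | h'
      · exact h.hasSplit_insert hv h'
      · simpa [or_comm] using h.compl.hasSplit_insert hv h'
    · rw [Finset.card_insert_of_notMem hv] at hX
      obtain ⟨w, rfl⟩ := Finset.card_eq_one.1 (show X.card = 1 by omega)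
      have hvw : v ≠ w := by simpa using hv
      by_cases hadj : G.Adj v w
      · refine Or.inr ⟨{v}, by simp, by simp, ⟨w, by simp, by simp [hvw.symm]⟩, ?_⟩
        simp_all
      · refine Or.inl ⟨{v}, by simp, by simp, ⟨w, by simp, by simp [hvw.symm]⟩, ?_⟩
        simp_all

/-- A component of the graph induced on `t` that meets a set `s` with no edges to `t \ s` is a
component of the graph induced on `s`. -/
theorem SimpleGraph.Reachable.induce_of_isolated {V : Type*} {G : SimpleGraph V} {s t : Set V}
    (hst : ∀ x ∈ s, ∀ y ∈ t, y ∉ s → ¬G.Adj x y) {u v : t} (h : (G.induce t).Reachable u v)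
    (hu : (u : V) ∈ s) : ∃ hv : (v : V) ∈ s, (G.induce s).Reachable ⟨u, hu⟩ ⟨v, hv⟩ := by
  obtain ⟨p⟩ := h
  induction p with
  | nil => exact ⟨hu, .rfl⟩
  | @cons u w v huw p ih =>
    have huw : G.Adj u w := huw
    have hw : (w : V) ∈ s := by
      by_contra hw
      exact hst u hu w w.2 hw huw
    obtain ⟨hv, hr⟩ := ih hw
    exact ⟨hv, .trans (Adj.reachable (show (G.induce s).Adj ⟨u, hu⟩ ⟨w, hw⟩ from huw)) hr⟩

theorem numComponents_eq_add {S : Type*} [Finite S] [DecidableEq S] {G : SimpleGraph S}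
    {X Y : Finset S} (h : ∀ y ∈ X ∩ Y, ∀ z ∈ X \ Y, ¬G.Adj y z) :
    numComponents G X = numComponents G (X ∩ Y) + numComponents G (X \ Y) := by
  have hi : ((X ∩ Y : Finset S) : Set S) ⊆ (X : Set S) := by exact_mod_cast Finset.inter_subset_left
  have hd : ((X \ Y : Finset S) : Set S) ⊆ (X : Set S) := by exact_mod_cast Finset.sdiff_subset
  have hci : ∀ x ∈ ((X ∩ Y : Finset S) : Set S), ∀ y ∈ (X : Set S),
      y ∉ ((X ∩ Y : Finset S) : Set S) → ¬G.Adj x y := by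
    intro x hx y hy hyn
    refine h x (by simpa using hx) y ?_
    simp_all
  have hcd : ∀ x ∈ ((X \ Y : Finset S) : Set S), ∀ y ∈ (X : Set S),
      y ∉ ((X \ Y : Finset S) : Set S) → ¬G.Adj x y := by
    intro x hx y hy hyn hadj
    refine h y ?_ x (by simpa using hx) hadj.symm
    simp_all
  unfold numComponents
  rw [← Nat.card_sum]
  symm
  refine Nat.card_congr (Equiv.ofBijective (Sum.elim
    (ConnectedComponent.map (induceHomOfLE G hi).toHom)
    (ConnectedComponent.map (induceHomOfLE G hd).toHom)) ⟨?_, ?_⟩)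
  · rintro (a | a) (b | b) hab <;> induction a using ConnectedComponent.ind with | _ a => ?_ <;>
      induction b using ConnectedComponent.ind with | _ b => ?_ <;>
      simp only [Sum.elim_inl, Sum.elim_inr, ConnectedComponent.map_mk,
        ConnectedComponent.eq] at hab
    · obtain ⟨_, hr⟩ := hab.induce_of_isolated hci a.2
      exact congrArg _ (ConnectedComponent.sound hr)
    · obtain ⟨hb, _⟩ := hab.induce_of_isolated hci a.2
      exact absurd (Finset.mem_inter.1 hb).2 (Finset.mem_sdiff.1 b.2).2
    · obtain ⟨hb, _⟩ := hab.induce_of_isolated hcd a.2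
      exact absurd (Finset.mem_inter.1 b.2).2 (Finset.mem_sdiff.1 hb).2
    · obtain ⟨_, hr⟩ := hab.induce_of_isolated hcd a.2
      exact congrArg _ (ConnectedComponent.sound hr)
  · intro c
    induction c using ConnectedComponent.ind with | _ c => ?_
    obtain ⟨c, hc⟩ := c
    by_cases hcY : c ∈ Y
    · exact ⟨.inl (connectedComponentMk _ ⟨c, by simp_all⟩), rfl⟩
    · exact ⟨.inr (connectedComponentMk _ ⟨c, by simp_all⟩), rfl⟩

theorem numComponents_le_add_ncard {S : Type*} [Finite S] {G : SimpleGraph S} {X I : Finset S}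
    {Q : Set S} (hI : I ⊆ X) (hQ : Q ⊆ X)
    (h : ∀ u : (X : Set S), ∃ w : (X : Set S), ((w : S) ∈ I ∨ (w : S) ∈ Q) ∧
      (G.induce (X : Set S)).Reachable u w) :
    numComponents G X ≤ numComponents G I + Q.ncard := by
  have hI' : (I : Set S) ⊆ X := by exact_mod_cast hI
  unfold numComponents
  rw [← Nat.card_coe_set_eq, ← Nat.card_sum]
  refine Nat.card_le_card_of_surjective (Sum.elim
    (ConnectedComponent.map (induceHomOfLE G hI').toHom)
    (fun q : Q => connectedComponentMk _ ⟨q, hQ q.2⟩)) ?_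
  intro c
  induction c using ConnectedComponent.ind with | _ c => ?_
  obtain ⟨w, hw | hw, hr⟩ := h c
  · exact ⟨.inl (connectedComponentMk _ ⟨w, hw⟩), ConnectedComponent.sound hr.symm⟩
  · exact ⟨.inr ⟨w, hw⟩, ConnectedComponent.sound hr.symm⟩

theorem preconnected_induce_of_join {S : Type*} {G : SimpleGraph S} {X Y : Finset S}
    (hY : ∃ y ∈ X, y ∈ Y) (hZ : ∃ z ∈ X, z ∉ Y)
    (h : ∀ y ∈ X, y ∈ Y → ∀ z ∈ X, z ∉ Y → G.Adj y z) :
    (G.induce (X : Set S)).Preconnected := by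
  obtain ⟨y, hyX, hyY⟩ := hY
  obtain ⟨z, hzX, hzY⟩ := hZ
  have key : ∀ u : (X : Set S), (G.induce (X : Set S)).Reachable ⟨y, hyX⟩ u := by
    have hyz : (G.induce (X : Set S)).Adj ⟨y, hyX⟩ ⟨z, hzX⟩ := h y hyX hyY z hzX hzY
    rintro ⟨u, hu⟩
    by_cases huY : u ∈ Y
    · have huz : (G.induce (X : Set S)).Adj ⟨u, hu⟩ ⟨z, hzX⟩ := h u hu huY z hzX hzY
      exact hyz.reachable.trans huz.symm.reachable
    · exact Adj.reachable (show (G.induce (X : Set S)).Adj _ _ from h y hyX hyY u hu huY)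
  exact fun u v => (key u).symm.trans (key v)

theorem numComponents_le_one {S : Type*} {G : SimpleGraph S} {X : Finset S}
    (h : (G.induce (X : Set S)).Preconnected) : numComponents G X ≤ 1 := by
  have := h.subsingleton_connectedComponent
  exact Finite.card_le_one_iff_subsingleton.2 this

theorem one_le_numComponents {S : Type*} [Finite S] {G : SimpleGraph S} {X : Finset S}
    (h : X.Nonempty) : 1 ≤ numComponents G X := by
  obtain ⟨x, hx⟩ := h
  have : Nonempty (G.induce (X : Set S)).ConnectedComponent := ⟨connectedComponentMk _ ⟨x, hx⟩⟩
  exact Nat.card_pos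

/-- The vertices of `B \ A` adjacent to `A` but not to `A ∩ B`. -/
def outerNbhd {S : Type*} (G : SimpleGraph S) (A B : Finset S) : Set S :=
  {v | v ∈ B ∧ v ∉ A ∧ (∃ x ∈ A, G.Adj x v) ∧ ∀ x ∈ A, x ∈ B → ¬G.Adj x v}

theorem numComponents_le_of_preconnected {S : Type*} [Finite S] [DecidableEq S]
    {G : SimpleGraph S} {A B : Finset S} (hA : A.Nonempty)
    (h : (G.induce ((A ∪ B : Finset S) : Set S)).Preconnected) :
    numComponents G B ≤ numComponents G (A ∩ B) + (outerNbhd G A B).ncard := by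
  refine numComponents_le_add_ncard Finset.inter_subset_right (fun v hv => hv.1) ?_
  rintro ⟨u, hu⟩
  have hu' : u ∈ B := hu
  obtain ⟨a, ha⟩ := hA
  obtain ⟨p⟩ := h ⟨u, by simp [hu']⟩ ⟨a, by simp [ha]⟩
  by_cases haR : ∃ hw : a ∈ B, (G.induce (B : Set S)).Reachable ⟨u, hu⟩ ⟨a, hw⟩
  · obtain ⟨hw, hr⟩ := haR
    exact ⟨⟨a, hw⟩, Or.inl (by simp [ha, hw]), hr⟩
  obtain ⟨⟨⟨x, y⟩, hxy⟩, -, ⟨hx, hr⟩, hy⟩ := p.exists_boundary_dart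
    {w | ∃ hw : (w : S) ∈ B, (G.induce (B : Set S)).Reachable ⟨u, hu⟩ ⟨w, hw⟩}
    ⟨hu, .rfl⟩ haR
  obtain ⟨y, hyV⟩ := y
  obtain ⟨x, hxV⟩ := x
  have hxy : G.Adj x y := hxy
  have hyB : y ∉ B := fun hyB => hy ⟨hyB, hr.trans
    (Adj.reachable (show (G.induce (B : Set S)).Adj ⟨x, hx⟩ ⟨y, hyB⟩ from hxy))⟩
  have hyA : y ∈ A := by simpa [hyB] using hyV
  by_cases hxA : x ∈ A
  · exact ⟨⟨x, hx⟩, Or.inl (Finset.mem_inter.2 ⟨hxA, hx⟩), hr⟩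
  by_cases hz : ∃ z ∈ A, z ∈ B ∧ G.Adj z x
  · obtain ⟨z, hzA, hzB, hzx⟩ := hz
    exact ⟨⟨z, hzB⟩, Or.inl (Finset.mem_inter.2 ⟨hzA, hzB⟩), hr.trans
      (Adj.reachable (show (G.induce (B : Set S)).Adj ⟨x, hx⟩ ⟨z, hzB⟩ from hzx.symm))⟩
  · push Not at hz
    exact ⟨⟨x, hx⟩, Or.inr ⟨hx, hxA, ⟨y, hyA, hxy.symm⟩, hz⟩, hr⟩

theorem ncard_outerNbhd_add_le {S : Type*} [Finite S] [DecidableEq S] {G : SimpleGraph S}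
    {A B Y : Finset S} (h : ∀ y ∈ A ∪ B, y ∈ Y → ∀ z ∈ A ∪ B, z ∉ Y → ¬G.Adj y z) :
    (outerNbhd G (A ∩ Y) (B ∩ Y)).ncard + (outerNbhd G (A \ Y) (B \ Y)).ncard ≤
      (outerNbhd G A B).ncard := by
  rw [← Set.ncard_union_eq]
  · refine Set.ncard_le_ncard ?_
    rintro v (⟨hvB, hvA, ⟨x, hx, hxv⟩, hv⟩ | ⟨hvB, hvA, ⟨x, hx, hxv⟩, hv⟩) <;>
      simp only [Finset.mem_inter, Finset.mem_sdiff] at hvB hvA hx hv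
    · refine ⟨hvB.1, fun e => hvA ⟨e, hvB.2⟩, ⟨x, hx.1, hxv⟩, fun z hzA hzB hzv => ?_⟩
      by_cases hzY : z ∈ Y
      · exact hv z ⟨hzA, hzY⟩ ⟨hzB, hzY⟩ hzv
      · exact h v (by simp [hvB]) hvB.2 z (by simp [hzA]) hzY hzv.symm
    · refine ⟨hvB.1, fun e => hvA ⟨e, hvB.2⟩, ⟨x, hx.1, hxv⟩, fun z hzA hzB hzv => ?_⟩
      by_cases hzY : z ∈ Y
      · exact h z (by simp [hzA]) hzY v (by simp [hvB]) hvB.2 hzv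
      · exact hv z ⟨hzA, hzY⟩ ⟨hzB, hzY⟩ hzv
  · rw [Set.disjoint_left]
    intro v hv hv'
    exact (Finset.mem_sdiff.1 hv'.1).2 (Finset.mem_inter.1 hv.1).2

theorem IsCograph.numComponents_add_le {S : Type*} [Finite S] [DecidableEq S]
    {G : SimpleGraph S} (hG : IsCograph G) (A B : Finset S) :
    numComponents G A + numComponents G B ≤ numComponents G (A ∪ B) + numComponents G (A ∩ B) +
      (outerNbhd G A B).ncard + (outerNbhd G B A).ncard := by
  induction hn : (A ∪ B).card using Nat.strong_induction_on generalizing A B with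
  | _ n ih =>
  subst hn
  by_cases hAB : A ⊆ B
  · rw [Finset.union_eq_right.2 hAB, Finset.inter_eq_left.2 hAB]
    omega
  by_cases hBA : B ⊆ A
  · rw [Finset.union_eq_left.2 hBA, Finset.inter_eq_right.2 hBA]
    omega
  obtain ⟨a, ha, haB⟩ := Finset.not_subset.1 hAB
  obtain ⟨b, hb, hbA⟩ := Finset.not_subset.1 hBA
  have hcard : 1 < (A ∪ B).card :=
    Finset.one_lt_card.2 ⟨a, by simp [ha], b, by simp [hb], fun e => hbA (e ▸ ha)⟩
  rcases hG.hasSplit_or_compl _ hcard with ⟨Y, hYV, ⟨y, hy⟩, ⟨z, hz, hzY⟩, hYZ⟩ |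
    ⟨Y, hYV, ⟨y, hy⟩, ⟨z, hz, hzY⟩, hYZ⟩
  · have e1 : (A ∩ Y) ∪ (B ∩ Y) = (A ∪ B) ∩ Y := Finset.union_inter_distrib_right _ _ _ |>.symm
    have e2 : (A \ Y) ∪ (B \ Y) = (A ∪ B) \ Y := Finset.union_sdiff_distrib _ _ _ |>.symm
    have e3 : (A ∩ Y) ∩ (B ∩ Y) = (A ∩ B) ∩ Y := by grind
    have e4 : (A \ Y) ∩ (B \ Y) = (A ∩ B) \ Y := by grind
    have i1 := ih _ (Finset.card_lt_card (Finset.ssubset_iff_subset_ne.2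
      ⟨e1.trans_le Finset.inter_subset_left, fun e => ?_⟩)) (A ∩ Y) (B ∩ Y) rfl
    · have i2 := ih _ (Finset.card_lt_card (Finset.ssubset_iff_subset_ne.2
        ⟨e2.trans_le Finset.sdiff_subset, fun e => ?_⟩)) (A \ Y) (B \ Y) rfl
      · have o1 := ncard_outerNbhd_add_le (G := G) (A := A) (B := B) (Y := Y)
          fun y _ hy z hz hzY => hYZ y hy z hz hzY
        have o2 := ncard_outerNbhd_add_le (G := G) (A := B) (B := A) (Y := Y)
          fun y _ hy z hz hzY => hYZ y hy z (by rwa [Finset.union_comm]) hzY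
        have additive : ∀ X ⊆ A ∪ B, numComponents G X =
            numComponents G (X ∩ Y) + numComponents G (X \ Y) := fun X hX =>
          numComponents_eq_add fun y hy z hz => hYZ y (Finset.mem_inter.1 hy).2 z
            (hX (Finset.mem_sdiff.1 hz).1) (Finset.mem_sdiff.1 hz).2
        have a1 := additive A Finset.subset_union_left
        have a2 := additive B Finset.subset_union_right
        have a3 := additive (A ∪ B) subset_rfl
        have a4 := additive (A ∩ B) (Finset.inter_subset_left.trans Finset.subset_union_left)
        rw [e1, e3] at i1
        rw [e2, e4] at i2
        omega
      · have := hYV hy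
        rw [← e, e2] at this
        exact (Finset.mem_sdiff.1 this).2 hy
    · rw [← e, e1] at hz
      exact hzY (Finset.mem_inter.1 hz).2
  · have join : ∀ y ∈ A ∪ B, y ∈ Y → ∀ z ∈ A ∪ B, z ∉ Y → G.Adj y z := by
      intro y _ hy z hz hzY
      have hne : y ≠ z := fun e => hzY (e ▸ hy)
      simpa [hne] using hYZ y hy z hz hzY
    have hpre := preconnected_induce_of_join ⟨y, hYV hy, hy⟩ ⟨z, hz, hzY⟩ join
    have hB := numComponents_le_of_preconnected ⟨a, ha⟩ hpre
    have hA := numComponents_le_of_preconnected (A := B) (B := A) ⟨b, hb⟩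
      (by rwa [Finset.union_comm])
    rw [Finset.inter_comm] at hA
    have hV := one_le_numComponents (G := G) ⟨y, hYV hy⟩
    rcases (A ∩ B).eq_empty_or_nonempty with hI | ⟨i, hi⟩
    · have h0 : numComponents G (A ∩ B) = 0 := by
        rw [hI]
        unfold numComponents
        have : IsEmpty ((∅ : Finset S) : Set S) := by simp
        have : IsEmpty (G.induce ((∅ : Finset S) : Set S)).ConnectedComponent :=
          ⟨ConnectedComponent.ind fun v => isEmptyElim v⟩
        exact Nat.card_of_isEmpty
      omega
    · have one : ∀ X ⊆ A ∪ B, (∃ y ∈ X, y ∈ Y) → (∃ z ∈ X, z ∉ Y) → numComponents G X ≤ 1 :=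
        fun X hX h1 h2 => numComponents_le_one (preconnected_induce_of_join h1 h2
          fun y hy hyY z hz hzY => join y (hX hy) hyY z (hX hz) hzY)
      have oneA := one A Finset.subset_union_left
      have oneB := one B Finset.subset_union_right
      have : numComponents G A ≤ 1 ∨ numComponents G B ≤ 1 := by
        have := hYV hy
        simp only [Finset.mem_union, Finset.mem_inter] at this hz hi
        by_cases hiY : i ∈ Y
        · rcases hz with hz | hz
          · exact .inl (oneA ⟨i, hi.1, hiY⟩ ⟨z, hz, hzY⟩)
          · exact .inr (oneB ⟨i, hi.2, hiY⟩ ⟨z, hz, hzY⟩)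
        · rcases this with hy' | hy'
          · exact .inl (oneA ⟨y, hy', hy⟩ ⟨i, hi.1, hiY⟩)
          · exact .inr (oneB ⟨y, hy', hy⟩ ⟨i, hi.2, hiY⟩)
      omega

theorem ncard_nbhdIn_union_left {S : Type*} [Finite S] [DecidableEq S] (G : SimpleGraph S)
    (A B : Finset S) : (nbhdIn G (A ∪ B) A).ncard =
      (outerNbhd G A B).ncard + (nbhdIn G (A ∪ B) (A ∩ B) ∩ B).ncard := by
  rw [← Set.ncard_union_eq]
  · congr 1
    ext v
    simp only [nbhdIn, outerNbhd, Set.mem_union, Set.mem_inter_iff, Set.mem_ofPred_eq,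
      Finset.mem_union, Finset.mem_inter, Finset.mem_coe]
    grind
  · rw [Set.disjoint_left]
    rintro v ⟨-, -, -, hv⟩ ⟨⟨-, -, x, hx, hxv⟩, -⟩
    exact hv x (Finset.mem_inter.1 hx).1 (Finset.mem_inter.1 hx).2 hxv

theorem ncard_nbhdIn_inter {S : Type*} [Finite S] [DecidableEq S] (G : SimpleGraph S)
    (A B : Finset S) : (nbhdIn G (A ∪ B) (A ∩ B)).ncard =
      (nbhdIn G (A ∪ B) (A ∩ B) ∩ B).ncard + (nbhdIn G (A ∪ B) (A ∩ B) ∩ A).ncard := by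
  rw [← Set.ncard_union_eq]
  · congr 1
    ext v
    simp only [nbhdIn, Set.mem_union, Set.mem_inter_iff, Set.mem_ofPred_eq,
      Finset.mem_union, Finset.mem_inter, Finset.mem_coe]
    grind
  · rw [Set.disjoint_left]
    rintro v ⟨⟨-, hv, -⟩, hB⟩ ⟨-, hA⟩
    exact hv (Finset.mem_inter.2 ⟨hA, hB⟩)

/-- Submodularity-type inequality for cographs (Claim in the Egawa–Ozeki
characterization proof). -/
theorem cograph_submodular_claim
    {S : Type*} [Fintype S] [DecidableEq S] (H : SimpleGraph S) (hcog : IsCograph H)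
    (A B : Finset S) :
    (Nat.card (nbhdIn H (A ∪ B) (A ∪ B)) : ℤ) - numComponents H (A ∪ B) +
      (Nat.card (nbhdIn H (A ∪ B) (A ∩ B)) : ℤ) - numComponents H (A ∩ B) ≤
    (Nat.card (nbhdIn H (A ∪ B) A) : ℤ) - numComponents H A +
      (Nat.card (nbhdIn H (A ∪ B) B) : ℤ) - numComponents H B := by
  have hmain := hcog.numComponents_add_le A B
  have hA := ncard_nbhdIn_union_left H A B
  have hB := ncard_nbhdIn_union_left H B A
  rw [Finset.union_comm B A, Finset.inter_comm B A] at hB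
  have hI := ncard_nbhdIn_inter H A B
  have h0 : nbhdIn H (A ∪ B) (A ∪ B) = ∅ :=
    Set.eq_empty_of_forall_notMem fun v hv => hv.2.1 hv.1
  simp only [Nat.card_coe_set_eq, h0, Set.ncard_empty]
  omega
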